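/- Let a, b be complex numbers, let k be a nonnegative integer, and let x be a complex number with Im(a·x + b) > 0. Then the k-th iterated derivative of t ↦ tan(a·t + b) at x equals i·δ_{0k} + 2i·(2i a)^k·Li_{-k}(-e^{2i(a x + b)}), where δ_{0k} = 1 if k = 0 and 0 otherwise; explicitly, it equals i·δ_{0k} + 2i·(2i a)^k·Σ_{n=1}^{∞} (-1)^n n^k e^{2i(a x + b)n}. -/

import Mathlib

open Finset Complex

lemma aux_norm_term (n k : ℕ) (w : ℂ) :
    ‖(-1 : ℂ) ^ (n + 1) * ((n : ℂ) + 1) ^ k * w ^ n‖ = ((n : ℝ) + 1) ^ k * ‖w‖ ^ n := by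
  have h1 : ‖((n : ℂ) + 1)‖ = (n : ℝ) + 1 := by
    have := Complex.norm_natCast (n + 1)
    push_cast at this
    exact this
  simp [norm_pow, h1]

lemma aux_summable (k : ℕ) (r : ℝ) (h0 : 0 < r) (h1 : r < 1) :
    Summable (fun n : ℕ => ((n : ℝ) + 1) ^ k * r ^ n) := by
  have h := summable_pow_mul_geometric_of_norm_lt_one (R := ℝ) k (r := r)
    (by rw [Real.norm_eq_abs, abs_of_pos h0]; exact h1)
  have h2 := ((summable_nat_add_iff 1).2 h).mul_right r⁻¹
  refine h2.congr fun n => ?_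
  push_cast
  field_simp
  ring

lemma aux_hasDerivAt (k : ℕ) (w : ℂ) (hw : ‖w‖ < 1) :
    HasDerivAt (fun w : ℂ => ∑' n : ℕ, (-1 : ℂ) ^ (n + 1) * ((n : ℂ) + 1) ^ k * w ^ (n + 1))
      (∑' n : ℕ, (-1 : ℂ) ^ (n + 1) * ((n : ℂ) + 1) ^ (k + 1) * w ^ n) w := by
  obtain ⟨r, hr, hr1⟩ := exists_between hw
  have hr0 : 0 < r := lt_of_le_of_lt (norm_nonneg _) hr
  refine hasDerivAt_tsum_of_isPreconnected (𝕜 := ℂ) (F := ℂ)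
    (g := fun (n : ℕ) (w : ℂ) => (-1 : ℂ) ^ (n + 1) * ((n : ℂ) + 1) ^ k * w ^ (n + 1))
    (g' := fun (n : ℕ) (w : ℂ) => (-1 : ℂ) ^ (n + 1) * ((n : ℂ) + 1) ^ (k + 1) * w ^ n)
    (t := Metric.ball (0 : ℂ) r) (y₀ := 0)
    (aux_summable (k + 1) r hr0 hr1) Metric.isOpen_ball
    (convex_ball (0 : ℂ) r).isPreconnected ?_ ?_ (by simpa using hr0) ?_ (by simpa using hr)
  · intro n y _
    have := (hasDerivAt_pow (n + 1) y).const_mul ((-1 : ℂ) ^ (n + 1) * ((n : ℂ) + 1) ^ k)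
    refine this.congr_deriv ?_
    rw [Nat.add_sub_cancel]
    push_cast
    ring
  · intro n y hy
    rw [aux_norm_term]
    have : ‖y‖ ≤ r := by simpa using (mem_ball_zero_iff.1 hy).le
    gcongr
  · simp

lemma aux_norm_exp (z : ℂ) (h : 0 < z.im) : ‖Complex.exp (2 * I * z)‖ < 1 := by
  rw [Complex.norm_exp, Real.exp_lt_one_iff]
  simp
  exact h

lemma aux_tan (z : ℂ) (h : 0 < z.im) :
    Complex.tan z = I + 2 * I *
      ∑' n : ℕ, (-1 : ℂ) ^ (n + 1) * Complex.exp (2 * I * z) ^ (n + 1) := by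
  have hq := aux_norm_exp z h
  have hsum : ∑' n : ℕ, (-1 : ℂ) ^ (n + 1) * Complex.exp (2 * I * z) ^ (n + 1)
      = -Complex.exp (2 * I * z) * (1 + Complex.exp (2 * I * z))⁻¹ := by
    have := tsum_geometric_of_norm_lt_one (ξ := -Complex.exp (2 * I * z)) (by simpa using hq)
    rw [sub_neg_eq_add] at this
    rw [← this, ← tsum_mul_left]
    refine tsum_congr fun n => ?_
    rw [← mul_pow, pow_succ]
    ring
  have hne : 1 + Complex.exp (2 * I * z) ≠ 0 := by
    intro h0
    have : Complex.exp (2 * I * z) = -1 := by linear_combination h0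
    rw [this] at hq
    simp at hq
  rw [hsum, Complex.tan, Complex.sin, Complex.cos]
  have e1 : Complex.exp (2 * I * z) = Complex.exp (z * I) ^ 2 := by
    rw [← Complex.exp_nat_mul]; congr 1; push_cast; ring
  have e2 : Complex.exp (-z * I) = (Complex.exp (z * I))⁻¹ := by
    rw [← Complex.exp_neg]; congr 1; ring
  have e3 := Complex.exp_ne_zero (z * I)
  rw [e1] at hne ⊢
  rw [e2]
  generalize Complex.exp (z * I) = u at *
  have hne2 : u ^ 2 + 1 ≠ 0 := by rwa [add_comm]
  have hne3 : u + u⁻¹ ≠ 0 := by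
    intro h0
    apply hne
    field_simp at h0
    linear_combination h0
  field_simp
  ring

/-- For `a b : ℂ`, `k : ℕ` and `x : ℂ` with `Im(a·x+b) > 0`,
`d^k/dx^k tan(ax+b) = i·δ_{0k} + 2i·(2ia)^k·Li_{-k}(-e^{2i(ax+b)})`,
where `Li_{-k}(-z) = ∑_{n=1}^∞ (-1)^n n^k z^n`. -/
theorem iteratedDeriv_tan_translated (a b : ℂ) (k : ℕ) (x : ℂ) (h : 0 < (a * x + b).im) :
    iteratedDeriv k (fun t => Complex.tan (a * t + b)) x =
      I * (if k = 0 then 1 else 0) + 2 * I * (2 * I * a) ^ k *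
        ∑' n : ℕ, (-1 : ℂ) ^ (n + 1) * ((n : ℂ) + 1) ^ k *
          Complex.exp (2 * I * (a * x + b)) ^ (n + 1) := by
  induction k generalizing x with
  | zero =>
    simp only [iteratedDeriv_zero, aux_tan _ h]
    simp
  | succ k ih =>
    rw [iteratedDeriv_succ]
    have hopen : IsOpen {t : ℂ | 0 < (a * t + b).im} :=
      isOpen_lt continuous_const (by fun_prop)
    have hev := Filter.eventually_of_mem (hopen.mem_nhds h) ih
    rw [Filter.EventuallyEq.deriv_eq hev]
    have hin : HasDerivAt (fun t : ℂ => Complex.exp (2 * I * (a * t + b)))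
        (Complex.exp (2 * I * (a * x + b)) * (2 * I * a)) x := by
      have h1 : HasDerivAt (fun t : ℂ => 2 * I * (a * t + b)) (2 * I * a) x := by
        simpa using (((hasDerivAt_id x).const_mul a).add_const b).const_mul (2 * I)
      exact h1.cexp
    have hd := ((HasDerivAt.comp x (aux_hasDerivAt k _ (aux_norm_exp _ h)) hin).const_mul
      (2 * I * (2 * I * a) ^ k)).const_add (I * (if k = 0 then 1 else 0))
    refine hd.deriv.trans ?_
    have : ∑' n : ℕ, (-1 : ℂ) ^ (n + 1) * ((n : ℂ) + 1) ^ (k + 1) *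
          Complex.exp (2 * I * (a * x + b)) ^ (n + 1) =
        (∑' n : ℕ, (-1 : ℂ) ^ (n + 1) * ((n : ℂ) + 1) ^ (k + 1) *
          Complex.exp (2 * I * (a * x + b)) ^ n) * Complex.exp (2 * I * (a * x + b)) := by
      rw [← tsum_mul_right]
      exact tsum_congr fun n => by ring
    rw [this, if_neg (Nat.succ_ne_zero k)]
    ring
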